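/- Let v ∈ ℝⁿ and let H be a symmetric positive definite matrix such that F(p_H(v)) ≤ Q_H(p_H(v), v). Then for every x ∈ ℝⁿ, 2(F(x) − F(p_H(v))) ≥ ‖p_H(v) − v‖_H² + 2⟨p_H(v) − v, v − x⟩_H = ‖p_H(v) − x‖_H² − ‖v − x‖_H². -/

import Mathlib

open scoped RealInnerProductSpace
open Finset

/-- Matrix-vector product, viewed as an operation on Euclidean space. -/
noncomputable def mulVecE {n : ℕ} (H : Matrix (Fin n) (Fin n) ℝ)
    (w : EuclideanSpace ℝ (Fin n)) : EuclideanSpace ℝ (Fin n) :=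
  (WithLp.equiv 2 (Fin n → ℝ)).symm (H.mulVec ((WithLp.equiv 2 (Fin n → ℝ)) w))

/-- The composite quadratic approximation
`Q_H(u,v) = f(v) + ⟨∇f(v), u−v⟩ + (1/2)⟨H(u−v), u−v⟩ + g(u)`. -/
noncomputable def Qa {n : ℕ} (f g : EuclideanSpace ℝ (Fin n) → ℝ)
    (H : Matrix (Fin n) (Fin n) ℝ) (u v : EuclideanSpace ℝ (Fin n)) : ℝ :=
  f v + ⟪ gradient f v, u - v ⟫ + (1 / 2) * ⟪ mulVecE H (u - v), u - v ⟫ + g u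

lemma nonneg_of_forall_add_mul_nonneg {A C : ℝ}
    (h : ∀ t : ℝ, 0 < t → t ≤ 1 → 0 ≤ A + t * C) : 0 ≤ A := by
  by_contra! hA
  have hC := abs_nonneg C
  have hD : 0 < -A + |C| + 1 := by linarith
  have h1 := h (-A / (-A + |C| + 1)) (div_pos (by linarith) hD)
    ((div_le_one hD).2 (by linarith))
  have h2 : -A / (-A + |C| + 1) * (-A + |C| + 1) = -A := div_mul_cancel₀ _ hD.ne'
  have h3 : 0 < -A / (-A + |C| + 1) := div_pos (by linarith) hD
  nlinarith [le_abs_self C]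

lemma ConvexOn.add_inner_gradient_le {E : Type*} [NormedAddCommGroup E]
    [InnerProductSpace ℝ E] [CompleteSpace E] {f : E → ℝ}
    (hf : ConvexOn ℝ Set.univ f) {v : E} (hfd : DifferentiableAt ℝ f v) (x : E) :
    f v + ⟪gradient f v, x - v⟫ ≤ f x := by
  have hc : ConvexOn ℝ Set.univ (f ∘ AffineMap.lineMap (k := ℝ) v x) := by
    simpa using hf.comp_affineMap (AffineMap.lineMap (k := ℝ) v x)
  have hd : HasDerivAt (f ∘ AffineMap.lineMap (k := ℝ) v x) ⟪gradient f v, x - v⟫ 0 := by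
    have h1 := hfd.hasGradientAt.hasFDerivAt
    have h2 : HasDerivAt (AffineMap.lineMap (k := ℝ) v x) (x - v) (0 : ℝ) :=
      AffineMap.hasDerivAt_lineMap
    have h1' : HasFDerivAt f (InnerProductSpace.toDual ℝ E (gradient f v))
        (AffineMap.lineMap (k := ℝ) v x (0 : ℝ)) := by simpa using h1
    simpa using h1'.comp_hasDerivAt (0 : ℝ) h2
  have h := hc.le_slope_of_hasDerivAt (Set.mem_univ 0) (Set.mem_univ 1) one_pos hd
  simp only [slope_def_field, Function.comp_apply, AffineMap.lineMap_apply_zero,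
    AffineMap.lineMap_apply_one, sub_zero, div_one] at h
  linarith

lemma mulVecE_add {n : ℕ} (H : Matrix (Fin n) (Fin n) ℝ) (a b : EuclideanSpace ℝ (Fin n)) :
    mulVecE H (a + b) = mulVecE H a + mulVecE H b :=
  map_add (Matrix.toEuclideanLin H) a b

lemma mulVecE_smul {n : ℕ} (H : Matrix (Fin n) (Fin n) ℝ) (t : ℝ)
    (a : EuclideanSpace ℝ (Fin n)) : mulVecE H (t • a) = t • mulVecE H a :=
  map_smul (Matrix.toEuclideanLin H) t a

lemma inner_mulVecE_comm {n : ℕ} {H : Matrix (Fin n) (Fin n) ℝ} (hH : H.IsHermitian)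
    (a b : EuclideanSpace ℝ (Fin n)) : ⟪mulVecE H a, b⟫ = ⟪mulVecE H b, a⟫ :=
  (Matrix.isSymmetric_toEuclideanLin_iff.2 hH a b).trans (real_inner_comm _ _)

lemma inner_mulVecE_add_self {n : ℕ} {H : Matrix (Fin n) (Fin n) ℝ} (hH : H.IsHermitian)
    (a b : EuclideanSpace ℝ (Fin n)) :
    ⟪mulVecE H (a + b), a + b⟫ =
      ⟪mulVecE H a, a⟫ + 2 * ⟪mulVecE H a, b⟫ + ⟪mulVecE H b, b⟫ := by
  rw [mulVecE_add, inner_add_left, inner_add_right, inner_add_right,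
    inner_mulVecE_comm hH b a]
  ring

/-- First-order optimality of a minimizer of the quadratic model. -/
lemma Qa_optimality {n : ℕ} {f g : EuclideanSpace ℝ (Fin n) → ℝ}
    (hg : ConvexOn ℝ Set.univ g) {H : Matrix (Fin n) (Fin n) ℝ} (hH : H.IsHermitian)
    {v p : EuclideanSpace ℝ (Fin n)} (hp : ∀ u, Qa f g H p v ≤ Qa f g H u v)
    (x : EuclideanSpace ℝ (Fin n)) :
    0 ≤ ⟪gradient f v, x - p⟫ + ⟪mulVecE H (p - v), x - p⟫ + (g x - g p) := by
  refine nonneg_of_forall_add_mul_nonneg (C := (1 / 2) * ⟪mulVecE H (x - p), x - p⟫)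
    fun t ht ht1 => ?_
  have hq := hp (p + t • (x - p))
  have hgt : g (p + t • (x - p)) ≤ (1 - t) * g p + t * g x := by
    have := hg.2 (Set.mem_univ p) (Set.mem_univ x) (sub_nonneg.2 ht1) ht.le (by ring)
    rwa [show (1 - t) • p + t • x = p + t • (x - p) by module] at this
  have hs : p + t • (x - p) - v = (p - v) + t • (x - p) := by abel
  simp only [Qa, hs] at hq
  rw [inner_mulVecE_add_self hH, mulVecE_smul] at hq
  simp only [inner_add_right, real_inner_smul_left, real_inner_smul_right] at hq
  refine nonneg_of_mul_nonneg_right (a := t) ?_ ht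
  linarith

theorem stmt3 {n : ℕ} (f g : EuclideanSpace ℝ (Fin n) → ℝ)
    (hf : ConvexOn ℝ Set.univ f) (hfd : Differentiable ℝ f)
    (L : ℝ) (hL : 0 < L)
    (hflip : ∀ x y, ‖gradient f x - gradient f y‖ ≤ L * ‖x - y‖)
    (hg : ConvexOn ℝ Set.univ g) (hgc : Continuous g)
    (H : Matrix (Fin n) (Fin n) ℝ) (hH : H.PosDef)
    (v p : EuclideanSpace ℝ (Fin n))
    (hp : ∀ u, Qa f g H p v ≤ Qa f g H u v)
    (hdec : f p + g p ≤ Qa f g H p v) :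
    ∀ x, 2 * ((f x + g x) - (f p + g p)) ≥
        ⟪ mulVecE H (p - v), p - v ⟫ + 2 * ⟪ mulVecE H (p - v), v - x ⟫ ∧
      ⟪ mulVecE H (p - v), p - v ⟫ + 2 * ⟪ mulVecE H (p - v), v - x ⟫
        = ⟪ mulVecE H (p - x), p - x ⟫ - ⟪ mulVecE H (v - x), v - x ⟫ := by
  intro x
  have hxp : p - x = (p - v) + (v - x) := by abel
  have hid := inner_mulVecE_add_self hH.isHermitian (p - v) (v - x)
  rw [← hxp] at hid
  refine ⟨?_, by linarith⟩
  have hgrad := hf.add_inner_gradient_le (hfd v) x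
  have hopt := Qa_optimality hg hH.isHermitian hp x
  have h1 : x - v = (x - p) + (p - v) := by abel
  have h2 : x - p = -((p - v) + (v - x)) := by abel
  have h3 : ⟪mulVecE H (p - v), x - p⟫ =
      -(⟪mulVecE H (p - v), p - v⟫ + ⟪mulVecE H (p - v), v - x⟫) := by
    rw [h2, inner_neg_right, inner_add_right]
  rw [h1, inner_add_right] at hgrad
  rw [Qa] at hdec
  linarith
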